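/- arXiv:2102.07180 — 10 statements merged into one kernel-verified Lean document; each statement's English description precedes it below -/
import Mathlib

section
/- Let η > 0 and let A, B > 0. Let χ : (0,∞) → (0,∞) be a continuous function with χ(r) → A as r → 0⁺ and χ(r) → B as r → ∞. Define Φ : (0,∞) → (0,1) by Φ(r)^{-1} = 1 + r²·χ(r). Then there exists s₀ > 0 such that for every real s with |s| ≤ s₀ and every r > 0, one has |Φ((1+s)·r)^{-1} − Φ(r)^{-1}| ≤ η·(Φ(r)^{-1} − 1). -/
open Filter Set

/-- A continuous function on the real line with finite limits at both ends is
uniformly continuous. -/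
theorem Continuous.uniformContinuous_of_tendsto_atBot_atTop {g : ℝ → ℝ} {a b : ℝ}
    (hg : Continuous g) (ha : Tendsto g atBot (nhds a)) (hb : Tendsto g atTop (nhds b)) :
    UniformContinuous g := by
  set h : ℝ → ℝ := fun t => a + (b - a) * min 1 (max 0 t) with h_def
  have hh : UniformContinuous h := by
    have hclamp : UniformContinuous fun t : ℝ => min 1 (max 0 t) :=
      ((LipschitzWith.id.const_max 0).const_min 1).uniformContinuous
    exact uniformContinuous_const.add (hclamp.const_mul' (b - a))
  have hbot : h =ᶠ[atBot] fun _ => a := by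
    filter_upwards [eventually_le_atBot 0] with t ht
    simp [h_def, max_eq_left ht]
  have htop : h =ᶠ[atTop] fun _ => b := by
    filter_upwards [eventually_ge_atTop 1] with t ht
    simp [h_def, max_eq_right (zero_le_one.trans ht), min_eq_left ht]
  have hlim : Tendsto (fun t => g t - h t) (cocompact ℝ) (nhds 0) := by
    rw [cocompact_eq_atBot_atTop, tendsto_sup]
    constructor
    · simpa using ha.sub (tendsto_const_nhds.congr' hbot.symm)
    · simpa using hb.sub (tendsto_const_nhds.congr' htop.symm)
  have hsub : UniformContinuous fun t => g t - h t :=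
    uniformContinuous_of_tendsto_cocompact (hg.sub hh.continuous) hlim
  simpa using hsub.add hh

/-- Proposition 4.2, abstract form. -/
theorem stmt_0 (η A B : ℝ) (hη : 0 < η) (hA : 0 < A) (hB : 0 < B)
    (χ : ℝ → ℝ) (hχcont : ContinuousOn χ (Set.Ioi 0))
    (hχpos : ∀ r > (0:ℝ), 0 < χ r)
    (hχ0 : Tendsto χ (nhdsWithin 0 (Set.Ioi 0)) (nhds A))
    (hχtop : Tendsto χ atTop (nhds B))
    (Φ : ℝ → ℝ)
    (hΦrange : ∀ r > (0:ℝ), Φ r ∈ Set.Ioo (0:ℝ) 1)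
    (hΦ : ∀ r > (0:ℝ), (Φ r)⁻¹ = 1 + r ^ 2 * χ r) :
    ∃ s₀ > (0:ℝ), ∀ s : ℝ, |s| ≤ s₀ → ∀ r > (0:ℝ),
      |(Φ ((1 + s) * r))⁻¹ - (Φ r)⁻¹| ≤ η * ((Φ r)⁻¹ - 1) := by
  have hχexp (t : ℝ) : 0 < χ (Real.exp t) := hχpos _ (Real.exp_pos t)
  have hg : UniformContinuous fun t => Real.log (χ (Real.exp t)) := by
    refine Continuous.uniformContinuous_of_tendsto_atBot_atTop (a := Real.log A)
      (b := Real.log B) ?_ ?_ ?_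
    · exact (hχcont.comp_continuous Real.continuous_exp Real.exp_pos).log
        fun t => (hχexp t).ne'
    · exact (hχ0.comp Real.tendsto_exp_atBot_nhdsGT).log hA.ne'
    · exact (hχtop.comp Real.tendsto_exp_atTop).log hB.ne'
  set u : ℝ → ℝ := fun t => 2 * t + Real.log (χ (Real.exp t)) with u_def
  have hu : UniformContinuous u := (uniformContinuous_id.const_mul' 2).add hg
  have hΦu (r : ℝ) (hr : 0 < r) : (Φ r)⁻¹ = 1 + Real.exp (u (Real.log r)) := by
    simp only [u_def, Real.exp_log hr]
    rw [hΦ r hr, Real.exp_add, Real.exp_log (hχpos r hr), two_mul, Real.exp_add,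
      Real.exp_log hr, sq]
  obtain ⟨ε, hε, hexp⟩ := Metric.continuousAt_iff.1 (Real.continuous_exp.continuousAt (x := 0)) η hη
  obtain ⟨δ, hδ, huδ⟩ := Metric.uniformContinuous_iff.1 hu ε hε
  obtain ⟨ρ, hρ, hlog⟩ := Metric.continuousAt_iff.1
    (Real.continuousAt_log (one_ne_zero : (1 : ℝ) ≠ 0)) δ hδ
  refine ⟨min (ρ / 2) (1 / 2), by positivity, fun s hs r hr => ?_⟩
  have hsρ : |s| < ρ := by linarith [hs.trans (min_le_left _ _)]
  have hs1 : 0 < 1 + s := by linarith [neg_abs_le s, hs.trans (min_le_right _ _)]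
  have hlogs : dist (Real.log ((1 + s) * r)) (Real.log r) < δ := by
    rw [Real.log_mul hs1.ne' hr.ne', dist_eq_norm, add_sub_cancel_right]
    simpa [Real.dist_eq] using hlog (x := 1 + s) (by simpa [Real.dist_eq] using hsρ)
  set x := u (Real.log ((1 + s) * r))
  set y := u (Real.log r)
  have hxy : |Real.exp (x - y) - 1| < η := by
    simpa [Real.dist_eq] using
      hexp (x := x - y) (by simpa [Real.dist_eq] using huδ hlogs)
  rw [hΦu _ (mul_pos hs1 hr), hΦu r hr]
  calc |1 + Real.exp x - (1 + Real.exp y)|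
      = |(Real.exp (x - y) - 1) * Real.exp y| := by
        rw [sub_mul, ← Real.exp_add, sub_add_cancel, one_mul, add_sub_add_left_eq_sub]
    _ = |Real.exp (x - y) - 1| * Real.exp y := by rw [abs_mul, Real.abs_exp]
    _ ≤ η * Real.exp y := by gcongr
    _ = η * (1 + Real.exp y - 1) := by rw [add_sub_cancel_left]
end

section
/- Let n ≥ 4 be an integer, and let α = 0 if n = 4 and α > (n−5)/(n−2) if n ≥ 5. Let Φ : (0,∞) → (0,∞) be continuously differentiable with r·Φ'(r) + 2·Φ(r) = 2(n−5)(n−2)³·r^{-4} + o(r^{-4}) and r²·Φ(r) → (n−2)² as r → ∞. Then there exists a constant L₀ > 0 with the following property: for every open interval J ⊆ ℝ and every smooth function B : J → (0,∞) satisfying B'(z) = √(Φ(B(z))) for all z ∈ J, if z ∈ J and B(z)² ≥ L₀²/4, then (d²/dz²)(B(z)²/2) − α·(B'(z))⁴ < 0. -/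
open Filter Asymptotics Set
open scoped ContDiff

/-- If `B' = √(Φ ∘ B)` on an open interval, then `(B² / 2)'' = Φ(B) + B Φ'(B) / 2` there. -/
theorem deriv_deriv_sq_div_two_of_deriv_eq_sqrt {Φ B : ℝ → ℝ} {a b z : ℝ}
    (hΦ : DifferentiableAt ℝ Φ (B z)) (hpos : 0 < Φ (B z))
    (hB : DifferentiableOn ℝ B (Ioo a b))
    (hode : ∀ w ∈ Ioo a b, deriv B w = Real.sqrt (Φ (B w))) (hz : z ∈ Ioo a b) :
    deriv (deriv (fun w => (B w) ^ 2 / 2)) z = Φ (B z) + B z * deriv Φ (B z) / 2 := by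
  have hd : ∀ w ∈ Ioo a b, HasDerivAt B (Real.sqrt (Φ (B w))) w := fun w hw =>
    hode w hw ▸ (hB.differentiableAt (isOpen_Ioo.mem_nhds hw)).hasDerivAt
  have hfirst : deriv (fun w => (B w) ^ 2 / 2) =ᶠ[nhds z]
      fun w => B w * Real.sqrt (Φ (B w)) := by
    filter_upwards [isOpen_Ioo.mem_nhds hz] with w hw
    rw [(((hd w hw).fun_pow 2).div_const 2).deriv]
    norm_num
    ring
  have hsecond := (hd z hz).fun_mul ((hΦ.hasDerivAt.comp z (hd z hz)).sqrt hpos.ne')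
  have hs : Real.sqrt (Φ (B z)) ≠ 0 := (Real.sqrt_pos.2 hpos).ne'
  rw [hfirst.deriv_eq]
  refine hsecond.deriv.trans ?_
  simp only [Function.comp_apply]
  rw [Real.mul_self_sqrt hpos.le]
  field_simp

/-- Under the asymptotics `r Φ' + 2 Φ = c r⁻⁴ + o(r⁻⁴)` and `r² Φ → k`, the quantity
`r Φ' + 2 Φ - 2 α Φ²` is eventually negative as soon as `c < 2 α k²`. -/
theorem eventually_mul_deriv_add_two_mul_sub_neg {Φ : ℝ → ℝ} {c k α : ℝ}
    (hasymp : (fun r : ℝ => r * deriv Φ r + 2 * Φ r - c * r ^ (-4:ℤ))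
      =o[atTop] fun r : ℝ => r ^ (-4:ℤ))
    (hlim : Tendsto (fun r : ℝ => r ^ 2 * Φ r) atTop (nhds k)) (hc : c < 2 * α * k ^ 2) :
    ∀ᶠ r : ℝ in atTop, r * deriv Φ r + 2 * Φ r - 2 * α * Φ r ^ 2 < 0 := by
  have hlim' := ((hasymp.tendsto_div_nhds_zero.add_const c).sub
    ((hlim.pow 2).const_mul (2 * α))).eventually_lt_const
      (show 0 + c - 2 * α * k ^ 2 < 0 by linarith)
  filter_upwards [hlim', eventually_gt_atTop (0 : ℝ)] with r hr hr0
  have hr4 : 0 < r ^ 4 := by positivity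
  have heq : (r * deriv Φ r + 2 * Φ r - c * r ^ (-4:ℤ)) / r ^ (-4:ℤ) + c
      - 2 * α * (r ^ 2 * Φ r) ^ 2
      = r ^ 4 * (r * deriv Φ r + 2 * Φ r - 2 * α * Φ r ^ 2) := by
    have hz : r ^ (-4:ℤ) = (r ^ 4)⁻¹ := by
      rw [zpow_neg]
      norm_cast
    rw [hz]
    field_simp
    ring
  rw [heq] at hr
  exact neg_of_mul_neg_right hr hr4.le

/-- Corollary 4.4 of the paper. -/
theorem stmt_2 (n : ℕ) (hn : 4 ≤ n) (α : ℝ)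
    (hα4 : n = 4 → α = 0)
    (hα5 : 5 ≤ n → ((n:ℝ) - 5) / ((n:ℝ) - 2) < α)
    (Φ : ℝ → ℝ)
    (hΦpos : ∀ r > (0:ℝ), 0 < Φ r)
    (hΦC1 : ContDiffOn ℝ 1 Φ (Set.Ioi 0))
    (hasymp : (fun r : ℝ => r * deriv Φ r + 2 * Φ r
        - 2 * ((n:ℝ) - 5) * ((n:ℝ) - 2) ^ 3 * r ^ (-4:ℤ))
      =o[atTop] fun r : ℝ => r ^ (-4:ℤ))
    (hlim : Tendsto (fun r : ℝ => r ^ 2 * Φ r) atTop (nhds (((n:ℝ) - 2) ^ 2))) :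
    ∃ L₀ > (0:ℝ), ∀ a b : ℝ, ∀ B : ℝ → ℝ,
      ContDiffOn ℝ ∞ B (Set.Ioo a b) →
      (∀ z ∈ Set.Ioo a b, 0 < B z) →
      (∀ z ∈ Set.Ioo a b, deriv B z = Real.sqrt (Φ (B z))) →
      ∀ z ∈ Set.Ioo a b, L₀ ^ 2 / 4 ≤ (B z) ^ 2 →
        deriv (deriv (fun w => (B w) ^ 2 / 2)) z - α * (deriv B z) ^ 4 < 0 := by
  have hc : 2 * ((n:ℝ) - 5) * ((n:ℝ) - 2) ^ 3 < 2 * α * (((n:ℝ) - 2) ^ 2) ^ 2 := by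
    rcases hn.eq_or_lt with h | h
    · rw [hα4 h.symm, ← h]
      norm_num
    · have hn5 : (5:ℝ) ≤ n := by exact_mod_cast h
      have hpos : (0:ℝ) < (n:ℝ) - 2 := by linarith
      have hα := (div_lt_iff₀ hpos).1 (hα5 h)
      nlinarith [mul_lt_mul_of_pos_right hα (pow_pos hpos 3)]
  obtain ⟨R, hR⟩ := eventually_atTop.1 (eventually_mul_deriv_add_two_mul_sub_neg hasymp hlim hc)
  refine ⟨2 * max R 1, by positivity, fun a b B hB hBpos hode z hz hL => ?_⟩
  have hBz := hBpos z hz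
  have hle : R ≤ B z := by
    refine (le_max_left R 1).trans ((pow_le_pow_iff_left₀ (by positivity) hBz.le two_ne_zero).1 ?_)
    linarith
  have hpos := hΦpos _ hBz
  have hΦd : DifferentiableAt ℝ Φ (B z) :=
    (hΦC1.differentiableOn one_ne_zero).differentiableAt (isOpen_Ioi.mem_nhds hBz)
  rw [deriv_deriv_sq_div_two_of_deriv_eq_sqrt hΦd hpos
    (hB.differentiableOn (by simp)) hode hz, hode z hz,
    show Real.sqrt (Φ (B z)) ^ 4 = Φ (B z) ^ 2 by
      rw [show 4 = 2 * 2 from rfl, pow_mul, Real.sq_sqrt hpos.le]]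
  linarith [hR (B z) hle]
end

section
/- Let n ≥ 4 be an integer, I ⊆ ℝ an open interval, and F : ℝ × I → (0,∞) a smooth function satisfying the rotationally symmetric Ricci flow profile equation F_t = F_zz − (n−2)·F^{-1}·(1 − F_z²) − (n−1)·F_z·∫₀^z (F_zz(z',t)/F(z',t)) dz', where subscripts denote partial derivatives. Define H(z,t) := (1/2)·F(z,t)² + (n−2)·t. Then for all (z,t) ∈ ℝ × I, H_zzt − H_zzzz = ((n−5)·F_z/F − (n−1)·∫₀^z (F_zz(z',t)/F(z',t)) dz')·H_zzz − 4(n−4)·F_z²·F_zz/F − 4·F_zz², where all functions on the right-hand side are evaluated at (z,t). -/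
open Filter Set intervalIntegral
open scoped ContDiff

/-- Partial derivative in the first variable. -/
noncomputable def d1 (F : ℝ → ℝ → ℝ) : ℝ → ℝ → ℝ := fun x y => deriv (fun x' => F x' y) x

/-- Partial derivative in the second variable. -/
noncomputable def d2 (F : ℝ → ℝ → ℝ) : ℝ → ℝ → ℝ := fun x y => deriv (fun y' => F x y') y

theorem hasDerivAt_fst {G : ℝ → ℝ → ℝ} {x y : ℝ}
    (hG : DifferentiableAt ℝ (fun p : ℝ × ℝ => G p.1 p.2) (x, y)) :
    HasDerivAt (fun x' => G x' y) (fderiv ℝ (fun p : ℝ × ℝ => G p.1 p.2) (x, y) (1, 0)) x :=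
  hG.hasFDerivAt.comp_hasDerivAt (f := fun x' => (x', y)) x
    ((hasDerivAt_id x).prodMk (hasDerivAt_const x y))

theorem hasDerivAt_snd {G : ℝ → ℝ → ℝ} {x y : ℝ}
    (hG : DifferentiableAt ℝ (fun p : ℝ × ℝ => G p.1 p.2) (x, y)) :
    HasDerivAt (fun y' => G x y') (fderiv ℝ (fun p : ℝ × ℝ => G p.1 p.2) (x, y) (0, 1)) y :=
  hG.hasFDerivAt.comp_hasDerivAt (f := fun y' => (x, y')) y
    ((hasDerivAt_const y x).prodMk (hasDerivAt_id y))

section Smooth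

variable {G : ℝ → ℝ → ℝ} {U : Set (ℝ × ℝ)}

theorem differentiableAt_of_smooth (hU : IsOpen U)
    (hG : ContDiffOn ℝ ∞ (fun p : ℝ × ℝ => G p.1 p.2) U) {p : ℝ × ℝ} (hp : p ∈ U) :
    DifferentiableAt ℝ (fun p : ℝ × ℝ => G p.1 p.2) p :=
  (hG.contDiffAt (hU.mem_nhds hp)).differentiableAt (by simp)

theorem d1_eqOn_fderiv (hU : IsOpen U)
    (hG : ContDiffOn ℝ ∞ (fun p : ℝ × ℝ => G p.1 p.2) U) :
    EqOn (fun p : ℝ × ℝ => d1 G p.1 p.2)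
      (fun p => fderiv ℝ (fun p : ℝ × ℝ => G p.1 p.2) p (1, 0)) U :=
  fun _ hp => (hasDerivAt_fst (differentiableAt_of_smooth hU hG hp)).deriv

theorem d2_eqOn_fderiv (hU : IsOpen U)
    (hG : ContDiffOn ℝ ∞ (fun p : ℝ × ℝ => G p.1 p.2) U) :
    EqOn (fun p : ℝ × ℝ => d2 G p.1 p.2)
      (fun p => fderiv ℝ (fun p : ℝ × ℝ => G p.1 p.2) p (0, 1)) U :=
  fun _ hp => (hasDerivAt_snd (differentiableAt_of_smooth hU hG hp)).deriv

theorem contDiffOn_d1 (hU : IsOpen U)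
    (hG : ContDiffOn ℝ ∞ (fun p : ℝ × ℝ => G p.1 p.2) U) :
    ContDiffOn ℝ ∞ (fun p : ℝ × ℝ => d1 G p.1 p.2) U :=
  ((hG.fderiv_of_isOpen hU (by simp)).clm_apply contDiffOn_const).congr (d1_eqOn_fderiv hU hG)

theorem contDiffOn_d2 (hU : IsOpen U)
    (hG : ContDiffOn ℝ ∞ (fun p : ℝ × ℝ => G p.1 p.2) U) :
    ContDiffOn ℝ ∞ (fun p : ℝ × ℝ => d2 G p.1 p.2) U :=
  ((hG.fderiv_of_isOpen hU (by simp)).clm_apply contDiffOn_const).congr (d2_eqOn_fderiv hU hG)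

theorem hasDerivAt_d1 (hU : IsOpen U)
    (hG : ContDiffOn ℝ ∞ (fun p : ℝ × ℝ => G p.1 p.2) U) {x y : ℝ} (hp : (x, y) ∈ U) :
    HasDerivAt (fun x' => G x' y) (d1 G x y) x :=
  (hasDerivAt_fst (differentiableAt_of_smooth hU hG hp)).differentiableAt.hasDerivAt

theorem hasDerivAt_d2 (hU : IsOpen U)
    (hG : ContDiffOn ℝ ∞ (fun p : ℝ × ℝ => G p.1 p.2) U) {x y : ℝ} (hp : (x, y) ∈ U) :
    HasDerivAt (fun y' => G x y') (d2 G x y) y :=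
  (hasDerivAt_snd (differentiableAt_of_smooth hU hG hp)).differentiableAt.hasDerivAt

/-- Mixed partial derivatives of a smooth function commute. -/
theorem d2_d1_eq_d1_d2 (hU : IsOpen U)
    (hG : ContDiffOn ℝ ∞ (fun p : ℝ × ℝ => G p.1 p.2) U) {x y : ℝ} (hp : (x, y) ∈ U) :
    d2 (d1 G) x y = d1 (d2 G) x y := by
  have hd : DifferentiableAt ℝ (fderiv ℝ (fun p : ℝ × ℝ => G p.1 p.2)) (x, y) :=
    ((hG.fderiv_of_isOpen hU (m := ∞) (by simp)).contDiffAt (hU.mem_nhds hp)).differentiableAt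
      (by simp)
  have hsymm : IsSymmSndFDerivAt ℝ (fun p : ℝ × ℝ => G p.1 p.2) (x, y) :=
    (hG.contDiffAt (hU.mem_nhds hp)).isSymmSndFDerivAt (by
      simpa using WithTop.coe_le_coe.2 (le_top (a := (2 : ℕ∞))))
  have key (v w : ℝ × ℝ) :
      fderiv ℝ (fun p => fderiv ℝ (fun p : ℝ × ℝ => G p.1 p.2) p v) (x, y) w
        = fderiv ℝ (fderiv ℝ (fun p : ℝ × ℝ => G p.1 p.2)) (x, y) w v := by
    simp [fderiv_clm_apply hd (differentiableAt_const v)]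
  have h21 := d2_eqOn_fderiv hU (contDiffOn_d1 hU hG) hp
  have h12 := d1_eqOn_fderiv hU (contDiffOn_d2 hU hG) hp
  simp only at h21 h12
  rw [h21, h12, ((d1_eqOn_fderiv hU hG).eventuallyEq_of_mem (hU.mem_nhds hp)).fderiv_eq,
    ((d2_eqOn_fderiv hU hG).eventuallyEq_of_mem (hU.mem_nhds hp)).fderiv_eq, key, key, hsymm.eq]

end Smooth

/-- evolution equation for `H_zz`, Lemma 4.8 of the paper. -/
theorem stmt_5 (n : ℕ) (hn : 4 ≤ n) (I : Set ℝ) (hIopen : IsOpen I) (hIconn : I.OrdConnected)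
    (F : ℝ → ℝ → ℝ)
    (hFsmooth : ContDiffOn ℝ ∞ (fun p : ℝ × ℝ => F p.1 p.2) (Set.univ ×ˢ I))
    (hFpos : ∀ z : ℝ, ∀ t ∈ I, 0 < F z t)
    (hF : ∀ z : ℝ, ∀ t ∈ I, d2 F z t = d1 (d1 F) z t
        - ((n:ℝ) - 2) * (F z t)⁻¹ * (1 - (d1 F z t) ^ 2)
        - ((n:ℝ) - 1) * d1 F z t * ∫ z' in (0:ℝ)..z, d1 (d1 F) z' t / F z' t)
    (H : ℝ → ℝ → ℝ)
    (hH : ∀ z t : ℝ, H z t = (1/2) * (F z t) ^ 2 + ((n:ℝ) - 2) * t) :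
    ∀ z : ℝ, ∀ t ∈ I,
      d2 (d1 (d1 H)) z t - d1 (d1 (d1 (d1 H))) z t
        = (((n:ℝ) - 5) * d1 F z t / F z t
            - ((n:ℝ) - 1) * ∫ z' in (0:ℝ)..z, d1 (d1 F) z' t / F z' t)
              * d1 (d1 (d1 H)) z t
          - 4 * ((n:ℝ) - 4) * (d1 F z t) ^ 2 * d1 (d1 F) z t / F z t
          - 4 * (d1 (d1 F) z t) ^ 2 := by
  have hU : IsOpen (univ ×ˢ I : Set (ℝ × ℝ)) := isOpen_univ.prod hIopen
  have mem {z t : ℝ} (ht : t ∈ I) : (z, t) ∈ (univ ×ˢ I : Set (ℝ × ℝ)) := ⟨mem_univ _, ht⟩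
  have hF1 := contDiffOn_d1 hU hFsmooth
  have hF2 := contDiffOn_d1 hU hF1
  have hHs : ContDiffOn ℝ ∞ (fun p : ℝ × ℝ => H p.1 p.2) (univ ×ˢ I) := by
    simp only [hH]
    exact (contDiffOn_const.mul (hFsmooth.pow 2)).add
      (contDiffOn_const.mul contDiff_snd.contDiffOn)
  have hH1 := contDiffOn_d1 hU hHs
  intro z t ht
  have D0 (x : ℝ) := hasDerivAt_d1 hU hFsmooth (mem (z := x) ht)
  have D1 (x : ℝ) := hasDerivAt_d1 hU hF1 (mem (z := x) ht)
  have D2 (x : ℝ) := hasDerivAt_d1 hU hF2 (mem (z := x) ht)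
  have hne (x : ℝ) : F x t ≠ 0 := (hFpos x t ht).ne'
  set J : ℝ → ℝ := fun x => ∫ z' in (0:ℝ)..x, d1 (d1 F) z' t / F z' t with hJ
  have DJ (x : ℝ) : HasDerivAt J (d1 (d1 F) x t / F x t) x := by
    have hc : Continuous fun x => d1 (d1 F) x t / F x t :=
      Continuous.div (continuous_iff_continuousAt.2 fun x => (D2 x).continuousAt)
        (continuous_iff_continuousAt.2 fun x => (D0 x).continuousAt) hne
    exact hc.integral_hasStrictDerivAt 0 x |>.hasDerivAt
  -- Spatial derivatives of `H`.
  have E1 (x : ℝ) : d1 H x t = F x t * d1 F x t := by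
    have h := (((D0 x).pow 2).const_mul (1/2)).add_const (((n:ℝ) - 2) * t)
    simp only [d1, hH]
    refine (h.deriv).trans ?_
    simp only [d1]
    ring
  have E2 (x : ℝ) : d1 (d1 H) x t = F x t * d1 (d1 F) x t + d1 F x t ^ 2 := by
    have h := (D0 x).mul (D1 x)
    rw [d1, funext E1]
    refine h.deriv.trans ?_
    ring
  have E3 (x : ℝ) : d1 (d1 (d1 H)) x t
      = F x t * d1 (d1 (d1 F)) x t + 3 * d1 F x t * d1 (d1 F) x t := by
    have h := ((D0 x).mul (D2 x)).add ((D1 x).pow 2)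
    rw [d1, funext E2]
    refine h.deriv.trans ?_
    ring
  have DH2 (x : ℝ) := hasDerivAt_d1 hU (contDiffOn_d1 hU hH1) (mem (z := x) ht)
  have DH3 (x : ℝ) :=
    hasDerivAt_d1 hU (contDiffOn_d1 hU (contDiffOn_d1 hU hH1)) (mem (z := x) ht)
  -- The evolution equations of `H`, `H_z` and `H_zz`.
  have T0 (x : ℝ) : d2 H x t = d1 (d1 H) x t + ((n:ℝ) - 3) * d1 F x t ^ 2
      - ((n:ℝ) - 1) * (F x t * d1 F x t * J x) := by
    have h := (((hasDerivAt_d2 hU hFsmooth (mem (z := x) ht)).pow 2).const_mul (1/2)).add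
      ((hasDerivAt_id t).const_mul ((n:ℝ) - 2))
    rw [d2, funext (hH x)]
    refine h.deriv.trans ?_
    rw [hF x t ht, E2 x]
    have := hne x
    simp only [hJ]
    field_simp
    ring
  have T1 (x : ℝ) : d1 (d2 H) x t = d1 (d1 (d1 H)) x t
      + ((n:ℝ) - 5) * (d1 F x t * d1 (d1 F) x t) - ((n:ℝ) - 1) * (d1 (d1 H) x t * J x) := by
    have h := ((DH2 x).add (((D1 x).pow 2).const_mul ((n:ℝ) - 3))).sub
      ((((D0 x).mul (D1 x)).mul (DJ x)).const_mul ((n:ℝ) - 1))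
    rw [d1, funext T0]
    refine h.deriv.trans ?_
    rw [E2 x]
    have := hne x
    simp only [Pi.mul_apply]
    field_simp
    ring
  have T2 : d1 (d1 (d2 H)) z t = d1 (d1 (d1 (d1 H))) z t
      + ((n:ℝ) - 5) * (d1 (d1 F) z t ^ 2 + d1 F z t * d1 (d1 (d1 F)) z t)
      - ((n:ℝ) - 1) * (d1 (d1 (d1 H)) z t * J z + d1 (d1 H) z t * (d1 (d1 F) z t / F z t)) := by
    have h := ((DH3 z).add (((D1 z).mul (D2 z)).const_mul ((n:ℝ) - 5))).sub
      (((DH2 z).mul (DJ z)).const_mul ((n:ℝ) - 1))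
    rw [d1, funext T1]
    refine h.deriv.trans ?_
    ring
  have hcomm : d2 (d1 (d1 H)) z t = d1 (d1 (d2 H)) z t := by
    rw [d2_d1_eq_d1_d2 hU hH1 (mem ht), d1,
      funext fun x => d2_d1_eq_d1_d2 hU hHs (mem (z := x) ht)]
    rfl
  change _ = (_ - ((n:ℝ) - 1) * J z) * _ - _ - _
  rw [hcomm, T2, E3 z, E2 z]
  have := hne z
  field_simp
  ring
end

section
/- Let θ > 0 and K* ≥ 0. Let μ : (0,2θ] → ℝ be twice continuously differentiable and suppose that μ''(ρ) ≤ (1/4)·μ'(ρ)² + (K*/4)·ρ^{-2} for all ρ ∈ (0,2θ]. Then for every smooth function f : ℝ → ℝ that is compactly supported in the open interval (0,2θ), ∫₀^{2θ} μ'(ρ)²·f(ρ)²·e^{-μ(ρ)} dρ ≤ 8·∫₀^{2θ} f'(ρ)²·e^{-μ(ρ)} dρ + K*·∫₀^{2θ} ρ^{-2}·f(ρ)²·e^{-μ(ρ)} dρ. -/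
open Filter Set intervalIntegral
open scoped ContDiff

/-- A function vanishing off a closed set and continuous at each point of it is continuous. -/
theorem continuous_of_eqOn_zero_compl {F : ℝ → ℝ} {S : Set ℝ} (hS : IsClosed S)
    (h0 : ∀ x ∉ S, F x = 0) (hc : ∀ x ∈ S, ContinuousAt F x) : Continuous F := by
  refine continuous_iff_continuousAt.2 fun x => ?_
  by_cases hx : x ∈ S
  · exact hc x hx
  · have h : F =ᶠ[nhds x] fun _ => 0 := by
      filter_upwards [hS.isOpen_compl.mem_nhds hx] with y hy using h0 y hy
    exact continuousAt_const.congr h.symm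

/-- weighted Poincaré inequality in the tip region,
Proposition 5.5 of the paper. -/
theorem stmt_10 (θ Kstar : ℝ) (hθ : 0 < θ) (hK : 0 ≤ Kstar)
    (μ : ℝ → ℝ)
    (hμ1 : ∀ ρ ∈ Set.Ioc (0:ℝ) (2*θ), DifferentiableAt ℝ μ ρ)
    (hμ2 : ∀ ρ ∈ Set.Ioc (0:ℝ) (2*θ), DifferentiableAt ℝ (deriv μ) ρ)
    (hμ2cont : ContinuousOn (deriv (deriv μ)) (Set.Ioc (0:ℝ) (2*θ)))
    (hμineq : ∀ ρ ∈ Set.Ioc (0:ℝ) (2*θ),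
      deriv (deriv μ) ρ ≤ (1/4) * (deriv μ ρ) ^ 2 + Kstar / 4 * ρ ^ (-2:ℤ)) :
    ∀ f : ℝ → ℝ, ContDiff ℝ ∞ f → HasCompactSupport f →
      tsupport f ⊆ Set.Ioo (0:ℝ) (2*θ) →
      (∫ ρ in (0:ℝ)..(2*θ), (deriv μ ρ) ^ 2 * (f ρ) ^ 2 * Real.exp (-μ ρ))
        ≤ 8 * (∫ ρ in (0:ℝ)..(2*θ), (deriv f ρ) ^ 2 * Real.exp (-μ ρ))
          + Kstar * ∫ ρ in (0:ℝ)..(2*θ), ρ ^ (-2:ℤ) * (f ρ) ^ 2 * Real.exp (-μ ρ) := by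
  intro f hf _ hsupp
  have hS : IsClosed (tsupport f) := isClosed_tsupport f
  have hf0 : ∀ x ∉ tsupport f, f x = 0 := fun x hx => image_eq_zero_of_notMem_tsupport hx
  have hfd : ∀ x, HasDerivAt f (deriv f x) x := fun x =>
    (hf.differentiable (by simp) x).hasDerivAt
  have hf'c : Continuous (deriv f) := hf.continuous_deriv (by simp)
  have hf'0 : ∀ x ∉ tsupport f, deriv f x = 0 := fun x hx =>
    image_eq_zero_of_notMem_tsupport fun h => hx (tsupport_deriv_subset h)
  have hmem : ∀ x ∈ tsupport f, x ∈ Set.Ioc (0:ℝ) (2*θ) := fun x hx =>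
    Ioo_subset_Ioc_self (hsupp hx)
  have hμc : ∀ x ∈ tsupport f, ContinuousAt μ x := fun x hx => (hμ1 x (hmem x hx)).continuousAt
  have hμ'c : ∀ x ∈ tsupport f, ContinuousAt (deriv μ) x := fun x hx =>
    (hμ2 x (hmem x hx)).continuousAt
  have hμ''c : ∀ x ∈ tsupport f, ContinuousAt (deriv (deriv μ)) x := fun x hx =>
    hμ2cont.continuousAt (mem_of_superset (isOpen_Ioo.mem_nhds (hsupp hx)) Ioo_subset_Ioc_self)
  have hfc : ∀ x, ContinuousAt f x := fun x => hf.continuous.continuousAt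
  have hwc : ∀ x ∈ tsupport f, ContinuousAt (fun ρ => Real.exp (-μ ρ)) x := fun x hx =>
    (hμc x hx).neg.rexp
  have hPc : Continuous fun ρ => (deriv μ ρ) ^ 2 * (f ρ) ^ 2 * Real.exp (-μ ρ) :=
    continuous_of_eqOn_zero_compl hS (fun x hx => by simp [hf0 x hx]) fun x hx =>
      (((hμ'c x hx).pow 2).mul ((hfc x).pow 2)).mul (hwc x hx)
  have hQc : Continuous fun ρ => (deriv f ρ) ^ 2 * Real.exp (-μ ρ) :=
    continuous_of_eqOn_zero_compl hS (fun x hx => by simp [hf'0 x hx]) fun x hx =>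
      (hf'c.continuousAt.pow 2).mul (hwc x hx)
  have hRc : Continuous fun ρ : ℝ => ρ ^ (-2:ℤ) * (f ρ) ^ 2 * Real.exp (-μ ρ) :=
    continuous_of_eqOn_zero_compl hS (fun x hx => by simp [hf0 x hx]) fun x hx =>
      ((continuousAt_zpow₀ x (-2) (Or.inl (hmem x hx).1.ne')).mul ((hfc x).pow 2)).mul (hwc x hx)
  set G : ℝ → ℝ := fun ρ => deriv μ ρ * (f ρ) ^ 2 * Real.exp (-μ ρ) with hG
  set G' : ℝ → ℝ := fun ρ => (deriv (deriv μ) ρ * (f ρ) ^ 2 + 2 * (deriv μ ρ * f ρ * deriv f ρ)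
    - (deriv μ ρ) ^ 2 * (f ρ) ^ 2) * Real.exp (-μ ρ) with hG'
  have hG'c : Continuous G' :=
    continuous_of_eqOn_zero_compl hS (fun x hx => by simp [hG', hf0 x hx]) fun x hx =>
      (((hμ''c x hx).mul ((hfc x).pow 2)).add
        (continuousAt_const.mul (((hμ'c x hx).mul (hfc x)).mul hf'c.continuousAt))
        |>.sub (((hμ'c x hx).pow 2).mul ((hfc x).pow 2))).mul (hwc x hx)
  have hGd : ∀ x, HasDerivAt G (G' x) x := by
    intro x
    by_cases hx : x ∈ tsupport f
    · have h := (((hμ2 x (hmem x hx)).hasDerivAt.mul ((hfd x).pow 2)).mul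
        (hμ1 x (hmem x hx)).hasDerivAt.neg.exp)
      refine h.congr_deriv ?_
      simp [hG']
      ring
    · have h : G =ᶠ[nhds x] fun _ => 0 := by
        filter_upwards [hS.isOpen_compl.mem_nhds hx] with y hy
        simp [hG, hf0 y hy]
      have h' : G' x = 0 := by simp [hG', hf0 x hx]
      rw [h']
      exact (hasDerivAt_const x (0:ℝ)).congr_of_eventuallyEq h
  have hint : ∫ ρ in (0:ℝ)..(2*θ), G' ρ = 0 := by
    rw [integral_eq_sub_of_hasDerivAt (fun x _ => hGd x) (hG'c.intervalIntegrable _ _)]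
    have h1 : f 0 = 0 := hf0 0 fun h => lt_irrefl _ (hsupp h).1
    have h2 : f (2*θ) = 0 := hf0 _ fun h => lt_irrefl _ (hsupp h).2
    simp [hG, h1, h2]
  have key : (∫ ρ in (0:ℝ)..(2*θ), (deriv μ ρ) ^ 2 * (f ρ) ^ 2 * Real.exp (-μ ρ))
      ≤ ∫ ρ in (0:ℝ)..(2*θ), (8 * ((deriv f ρ) ^ 2 * Real.exp (-μ ρ))
        + Kstar * (ρ ^ (-2:ℤ) * (f ρ) ^ 2 * Real.exp (-μ ρ)) - 2 * G' ρ) := by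
    refine integral_mono_on (by linarith) (hPc.intervalIntegrable _ _)
      ((((continuous_const.mul hQc).add (continuous_const.mul hRc)).sub
        (continuous_const.mul hG'c)).intervalIntegrable _ _) fun x _ => ?_
    by_cases hx : x ∈ tsupport f
    · have h1 := mul_le_mul_of_nonneg_right (hμineq x (hmem x hx)) (sq_nonneg (f x))
      have h2 : 0 ≤ Kstar * (x ^ (-2:ℤ) * (f x) ^ 2) :=
        mul_nonneg hK (mul_nonneg (zpow_nonneg (hmem x hx).1.le _) (sq_nonneg _))
      have h3 : (deriv μ x) ^ 2 * (f x) ^ 2 ≤ 8 * (deriv f x) ^ 2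
          + Kstar * (x ^ (-2:ℤ) * (f x) ^ 2) - 2 * (deriv (deriv μ) x * (f x) ^ 2
            + 2 * (deriv μ x * f x * deriv f x) - (deriv μ x) ^ 2 * (f x) ^ 2) := by
        linarith [sq_nonneg (deriv μ x * f x - 4 * deriv f x)]
      have h4 := mul_le_mul_of_nonneg_right h3 (Real.exp_pos (-μ x)).le
      simp only [hG']
      linarith
    · simp [hG', hf0 x hx, hf'0 x hx]
  have hQi : IntervalIntegrable (fun ρ => 8 * ((deriv f ρ) ^ 2 * Real.exp (-μ ρ)))
      MeasureTheory.volume 0 (2*θ) := (continuous_const.mul hQc).intervalIntegrable _ _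
  have hRi : IntervalIntegrable (fun ρ : ℝ => Kstar * (ρ ^ (-2:ℤ) * (f ρ) ^ 2 * Real.exp (-μ ρ)))
      MeasureTheory.volume 0 (2*θ) := (continuous_const.mul hRc).intervalIntegrable _ _
  have hGi : IntervalIntegrable (fun ρ => 2 * G' ρ) MeasureTheory.volume 0 (2*θ) :=
    (continuous_const.mul hG'c).intervalIntegrable _ _
  rw [integral_sub (hQi.add hRi) hGi, integral_add hQi hRi, integral_const_mul,
    integral_const_mul, integral_const_mul, hint] at key
  linarith
end

section
/- Let t* < 0 and ε ∈ (0,1). Let s : (−∞, t*] → ℝ be differentiable, with |s(t*)| ≤ ε·√(−t*). Suppose that at every t ≤ t* for which |s(t)| ≤ √(−t), the derivative satisfies |s'(t)| ≤ |s(t)|/(2(−t)). Then |s(t)| ≤ ε·√(−t) for all t ≤ t*. -/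
open Filter Set

/-- A function that cannot increase while it is at most `M` stays below any initial bound
`c < M`. -/
theorem image_le_of_deriv_nonpos_of_le {f f' : ℝ → ℝ} {a b c M : ℝ} (hab : a ≤ b) (hc : c < M)
    (hf : ∀ x ∈ Icc a b, HasDerivAt f (f' x) x) (ha : f a ≤ c)
    (hf' : ∀ x ∈ Icc a b, f x ≤ M → f' x ≤ 0) : f b ≤ c := by
  refine le_of_forall_pos_le_add fun δ hδ => ?_
  set m := min δ (M - c)
  have hm : 0 < m := lt_min hδ (sub_pos.2 hc)
  have hden : 0 < b - a + 1 := by linarith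
  set η := m / (b - a + 1)
  have hη : 0 < η := div_pos hm hden
  have hηm : η * (b - a + 1) = m := div_mul_cancel₀ _ hden.ne'
  have hB : ∀ x ≤ b, c + η * (x - a) ≤ c + m := fun x hx => by nlinarith
  have key := image_le_of_deriv_right_lt_deriv_boundary' (f := f) (f' := f') (a := a) (b := b)
    (B := fun x => c + η * (x - a)) (B' := fun _ => η)
    (fun x hx => (hf x hx).continuousAt.continuousWithinAt)
    (fun x hx => (hf x (Ico_subset_Icc_self hx)).hasDerivWithinAt)
    (by simpa using ha) (by fun_prop)
    (fun x _ => by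
      simpa using ((((hasDerivAt_id x).sub_const a).const_mul η).const_add c).hasDerivWithinAt)
    (fun x hx hfx => by
      refine (hf' x (Ico_subset_Icc_self hx) ?_).trans_lt hη
      have h1 := hB x hx.2.le
      have h2 : m ≤ M - c := min_le_right _ _
      linarith)
    (right_mem_Icc.2 hab)
  have h1 := hB b le_rfl
  have h2 : m ≤ δ := min_le_left _ _
  linarith

/-- For `t < 0` and `c ≥ 0`, the bound `|y| ≤ c √(-t)` is a bound on `y ^ 2 / (-t)`. -/
theorem abs_le_mul_sqrt_neg_iff {y c t : ℝ} (hc : 0 ≤ c) (ht : t < 0) :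
    |y| ≤ c * Real.sqrt (-t) ↔ y ^ 2 / (-t) ≤ c ^ 2 := by
  have ht' : 0 < -t := neg_pos.2 ht
  rw [div_le_iff₀ ht', ← abs_of_nonneg (mul_nonneg hc (Real.sqrt_nonneg (-t))), ← sq_le_sq,
    mul_pow, Real.sq_sqrt ht'.le]

/-- ODE comparison underlying Lemma 6.2 of the paper. -/
theorem stmt_11 (tstar ε : ℝ) (ht : tstar < 0) (hε : ε ∈ Set.Ioo (0:ℝ) 1)
    (s : ℝ → ℝ)
    (hdiff : ∀ t ≤ tstar, DifferentiableAt ℝ s t)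
    (hinit : |s tstar| ≤ ε * Real.sqrt (-tstar))
    (hode : ∀ t ≤ tstar, |s t| ≤ Real.sqrt (-t) → |deriv s t| ≤ |s t| / (2 * (-t))) :
    ∀ t ≤ tstar, |s t| ≤ ε * Real.sqrt (-t) := by
  intro t htt
  obtain ⟨hε0, hε1⟩ := hε
  rw [abs_le_mul_sqrt_neg_iff hε0.le ht] at hinit
  rw [abs_le_mul_sqrt_neg_iff hε0.le (htt.trans_lt ht)]
  have key := image_le_of_deriv_nonpos_of_le (f := fun u => s (-u) ^ 2 / u)
    (f' := fun u => (2 * s (-u) * (-deriv s (-u)) * u - s (-u) ^ 2) / u ^ 2)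
    (a := -tstar) (b := -t) (c := ε ^ 2) (M := 1) (neg_le_neg htt) (by nlinarith)
    (fun u hu => by
      have hu0 : u ≠ 0 := ne_of_gt (by linarith [hu.1])
      have hs : HasDerivAt (fun v => s (-v)) (-deriv s (-u)) u := by
        have hle : -u ≤ tstar := by linarith [hu.1]
        simpa [Function.comp_def] using (hdiff (-u) hle).hasDerivAt.comp u (hasDerivAt_neg u)
      exact ((hs.pow 2).div (hasDerivAt_id u) hu0).congr_deriv (by simp))
    (by simpa using hinit)
    (fun u hu hle => by
      have hu0 : 0 < u := by linarith [hu.1]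
      have habs : |s (-u)| ≤ Real.sqrt (-(-u)) := by
        simpa using (abs_le_mul_sqrt_neg_iff (y := s (-u)) zero_le_one (neg_neg_iff_pos.2 hu0)).2
          (by simpa using hle)
      have hd := hode (-u) (by linarith [hu.1]) habs
      rw [neg_neg, le_div_iff₀ (by positivity)] at hd
      refine div_nonpos_of_nonpos_of_nonneg ?_ (sq_nonneg u)
      have h1 := neg_abs_le (s (-u) * deriv s (-u))
      rw [abs_mul] at h1
      have h2 := mul_le_mul_of_nonneg_left hd (abs_nonneg (s (-u)))
      have h3 := mul_le_mul_of_nonneg_right h1 hu0.le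
      have h4 := abs_mul_abs_self (s (-u))
      nlinarith)
  simpa using key
end

section
/- Let f : ℝ → ℝ be locally integrable with ∫_ℝ e^{-ξ²/4}·f(ξ)² dξ < ∞, and define g(ξ) := ∫₀^ξ f(ξ') dξ'. Then ∫_ℝ e^{-ξ²/4}·g(ξ)² dξ ≤ 2·∫_ℝ e^{-ξ²/4}·f(ξ)² dξ. In particular, the operator f ↦ ∫₀^ξ f is bounded from the Gaussian space L²(ℝ, e^{-ξ²/4} dξ) to itself. -/
open Filter Set MeasureTheory intervalIntegral

/-- The Gaussian tail identity `∫_a^∞ e^{-x²/4} x dx = 2 e^{-a²/4}` for `a ≥ 0`. -/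
theorem lintegral_Ioi_exp_neg_sq_div_four_mul_self {a : ℝ} (ha : 0 ≤ a) :
    ∫⁻ x in Ioi a, ENNReal.ofReal (Real.exp (-x ^ 2 / 4)) * ENNReal.ofReal x
      = 2 * ENNReal.ofReal (Real.exp (-a ^ 2 / 4)) := by
  have hderiv : ∀ x ∈ Ici a, HasDerivAt (fun x : ℝ => -2 * Real.exp (-x ^ 2 / 4))
      (Real.exp (-x ^ 2 / 4) * x) x := by
    intro x _
    have h := ((((hasDerivAt_id x).pow 2).neg.div_const 4).exp).const_mul (-2 : ℝ)
    convert! h using 1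
    simp
    ring
  have hnonneg : ∀ x ∈ Ioi a, 0 ≤ Real.exp (-x ^ 2 / 4) * x := fun x hx =>
    mul_nonneg (Real.exp_pos _).le (ha.trans (le_of_lt hx))
  have hlim : Tendsto (fun x : ℝ => -2 * Real.exp (-x ^ 2 / 4)) atTop (nhds 0) := by
    have h : Tendsto (fun x : ℝ => -x ^ 2 / 4) atTop atBot :=
      (tendsto_neg_atTop_atBot.comp (tendsto_pow_atTop two_ne_zero)).atBot_div_const
        (by norm_num)
    simpa using (Real.tendsto_exp_atBot.comp h).const_mul (-2 : ℝ)
  calc ∫⁻ x in Ioi a, ENNReal.ofReal (Real.exp (-x ^ 2 / 4)) * ENNReal.ofReal x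
      = ∫⁻ x in Ioi a, ENNReal.ofReal (Real.exp (-x ^ 2 / 4) * x) := by
        simp_rw [ENNReal.ofReal_mul (Real.exp_pos _).le]
    _ = ENNReal.ofReal (∫ x in Ioi a, Real.exp (-x ^ 2 / 4) * x) :=
        (ofReal_integral_eq_lintegral_ofReal
          (integrableOn_Ioi_deriv_of_nonneg' hderiv hnonneg hlim)
          ((ae_restrict_iff' measurableSet_Ioi).2 (Eventually.of_forall hnonneg))).symm
    _ = 2 * ENNReal.ofReal (Real.exp (-a ^ 2 / 4)) := by
        rw [integral_Ioi_of_hasDerivAt_of_nonneg' hderiv hnonneg hlim, zero_sub, neg_mul, neg_neg,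
          ENNReal.ofReal_mul zero_le_two, ENNReal.ofReal_ofNat]

/-- Cauchy–Schwarz bound for a primitive vanishing at the origin. -/
theorem enorm_integral_sq_le_mul_lintegral {h : ℝ → ℝ} (hh : AEMeasurable h) {x : ℝ}
    (hx : 0 ≤ x) :
    ‖∫ t in (0 : ℝ)..x, h t‖ₑ ^ 2 ≤ ENNReal.ofReal x * ∫⁻ t in Ioc 0 x, ‖h t‖ₑ ^ 2 := by
  have hCS := ENNReal.lintegral_mul_le_Lp_mul_Lq (volume.restrict (Ioc 0 x))
    Real.HolderConjugate.two_two (f := fun _ => 1) (g := fun t => ‖h t‖ₑ)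
    aemeasurable_const hh.restrict.enorm
  simp only [Pi.mul_apply, one_mul, one_pow, lintegral_const, Measure.restrict_apply_univ,
    Real.volume_Ioc, sub_zero, ENNReal.rpow_two] at hCS
  rw [integral_of_le hx]
  calc ‖∫ t in Ioc 0 x, h t‖ₑ ^ 2
      ≤ (ENNReal.ofReal x ^ (1 / 2 : ℝ) * (∫⁻ t in Ioc 0 x, ‖h t‖ₑ ^ 2) ^ (1 / 2 : ℝ)) ^ 2 :=
        pow_le_pow_left' ((enorm_integral_le_lintegral_enorm _).trans hCS) 2
    _ = ENNReal.ofReal x * ∫⁻ t in Ioc 0 x, ‖h t‖ₑ ^ 2 := by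
        rw [mul_pow, ← ENNReal.rpow_mul_natCast, ← ENNReal.rpow_mul_natCast]
        norm_num

/-- The half-line version of the Gaussian bound for the antiderivative operator. -/
theorem lintegral_Ioi_exp_mul_primitive_sq_le {h : ℝ → ℝ} (hh : AEMeasurable h) :
    ∫⁻ x in Ioi 0, ENNReal.ofReal (Real.exp (-x ^ 2 / 4)) * ‖∫ t in (0 : ℝ)..x, h t‖ₑ ^ 2
      ≤ 2 * ∫⁻ x in Ioi 0, ENNReal.ofReal (Real.exp (-x ^ 2 / 4)) * ‖h x‖ₑ ^ 2 := by
  let u : ℝ → ENNReal := fun x => ENNReal.ofReal (Real.exp (-x ^ 2 / 4)) * ENNReal.ofReal x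
  have hu : Measurable u := by fun_prop
  let F : ℝ × ℝ → ENNReal := {p | p.2 ≤ p.1}.indicator fun p => u p.1 * ‖h p.2‖ₑ ^ 2
  have hF : AEMeasurable F ((volume.restrict (Ioi 0)).prod (volume.restrict (Ioi 0))) := by
    refine AEMeasurable.indicator ?_ (measurableSet_le measurable_snd measurable_fst)
    exact (hu.comp measurable_fst).aemeasurable.mul
      ((hh.restrict.comp_snd).enorm.pow_const 2)
  calc ∫⁻ x in Ioi 0, ENNReal.ofReal (Real.exp (-x ^ 2 / 4)) * ‖∫ t in (0 : ℝ)..x, h t‖ₑ ^ 2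
      ≤ ∫⁻ x in Ioi 0, ∫⁻ y in Ioi 0, F (x, y) := by
        refine setLIntegral_mono' measurableSet_Ioi fun x hx => ?_
        have hFx : (fun y => F (x, y)) = (Iic x).indicator fun y => u x * ‖h y‖ₑ ^ 2 := by
          ext y
          simp [F, indicator_apply]
        rw [hFx, lintegral_indicator measurableSet_Iic, Measure.restrict_restrict measurableSet_Iic,
          inter_comm, Ioi_inter_Iic, lintegral_const_mul'' _ (hh.restrict.enorm.pow_const 2),
          mul_assoc]
        gcongr
        exact enorm_integral_sq_le_mul_lintegral hh (le_of_lt hx)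
    _ = ∫⁻ y in Ioi 0, ∫⁻ x in Ioi 0, F (x, y) := lintegral_lintegral_swap hF
    _ ≤ ∫⁻ y in Ioi 0, 2 * (ENNReal.ofReal (Real.exp (-y ^ 2 / 4)) * ‖h y‖ₑ ^ 2) := by
        refine setLIntegral_mono' measurableSet_Ioi fun y hy => ?_
        have hFy : (fun x => F (x, y)) = (Ici y).indicator fun x => u x * ‖h y‖ₑ ^ 2 := by
          ext x
          simp [F, indicator_apply]
        rw [hFy, lintegral_indicator measurableSet_Ici, Measure.restrict_restrict measurableSet_Ici,
          inter_eq_left.2 (Ici_subset_Ioi.2 hy), lintegral_mul_const _ hu,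
          ← setLIntegral_congr Ioi_ae_eq_Ici,
          lintegral_Ioi_exp_neg_sq_div_four_mul_self (le_of_lt hy), mul_assoc]
    _ = 2 * ∫⁻ x in Ioi 0, ENNReal.ofReal (Real.exp (-x ^ 2 / 4)) * ‖h x‖ₑ ^ 2 :=
        lintegral_const_mul' _ _ ENNReal.ofNat_ne_top

theorem lintegral_eq_lintegral_Ioi_add_lintegral_Ioi_neg (φ : ℝ → ENNReal) :
    ∫⁻ x, φ x = (∫⁻ x in Ioi 0, φ x) + ∫⁻ x in Ioi 0, φ (-x) := by
  have h := (Measure.measurePreserving_neg (volume : Measure ℝ)).setLIntegral_comp_preimage_emb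
    (MeasurableEquiv.neg ℝ).measurableEmbedding φ (Iio 0)
  rw [neg_preimage, neg_Iio, neg_zero] at h
  rw [h, setLIntegral_congr Iio_ae_eq_Iic, ← compl_Ioi, lintegral_add_compl _ measurableSet_Ioi]

/-- The antiderivative operator is bounded for the Gaussian weight, in terms of lower integrals. -/
theorem lintegral_exp_mul_primitive_sq_le {h : ℝ → ℝ} (hh : AEMeasurable h) :
    ∫⁻ x, ENNReal.ofReal (Real.exp (-x ^ 2 / 4)) * ‖∫ t in (0 : ℝ)..x, h t‖ₑ ^ 2
      ≤ 2 * ∫⁻ x, ENNReal.ofReal (Real.exp (-x ^ 2 / 4)) * ‖h x‖ₑ ^ 2 := by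
  have hneg : AEMeasurable fun t => h (-t) :=
    hh.comp_quasiMeasurePreserving (Measure.measurePreserving_neg volume).quasiMeasurePreserving
  have hprim (x : ℝ) : ‖∫ t in (0 : ℝ)..-x, h t‖ₑ = ‖∫ t in (0 : ℝ)..x, h (-t)‖ₑ := by
    rw [integral_comp_neg, neg_zero, integral_symm, enorm_neg]
  rw [lintegral_eq_lintegral_Ioi_add_lintegral_Ioi_neg,
    lintegral_eq_lintegral_Ioi_add_lintegral_Ioi_neg
      (fun x => ENNReal.ofReal (Real.exp (-x ^ 2 / 4)) * ‖h x‖ₑ ^ 2), mul_add]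
  simp only [neg_sq, hprim]
  exact add_le_add (lintegral_Ioi_exp_mul_primitive_sq_le hh)
    (lintegral_Ioi_exp_mul_primitive_sq_le hneg)

/-- Proposition 7.1 (iv) of the paper: the antiderivative operator
is bounded on the Gaussian space `L²(ℝ, e^{-ξ²/4} dξ)`. -/
theorem stmt_12 (f : ℝ → ℝ)
    (hloc : LocallyIntegrable f volume)
    (hfin : Integrable (fun ξ : ℝ => Real.exp (-ξ ^ 2 / 4) * (f ξ) ^ 2))
    (g : ℝ → ℝ)
    (hg : ∀ ξ : ℝ, g ξ = ∫ ξ' in (0:ℝ)..ξ, f ξ') :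
    Integrable (fun ξ : ℝ => Real.exp (-ξ ^ 2 / 4) * (g ξ) ^ 2) ∧
      (∫ ξ : ℝ, Real.exp (-ξ ^ 2 / 4) * (g ξ) ^ 2)
        ≤ 2 * ∫ ξ : ℝ, Real.exp (-ξ ^ 2 / 4) * (f ξ) ^ 2 := by
  have hcont : Continuous g := by
    rw [funext hg]
    exact continuous_primitive
      (fun a b => (hloc.integrableOn_isCompact isCompact_uIcc).intervalIntegrable) 0
  have hmeas : AEStronglyMeasurable (fun ξ : ℝ => Real.exp (-ξ ^ 2 / 4) * (g ξ) ^ 2) :=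
    Continuous.aestronglyMeasurable (by fun_prop)
  have hnonneg (k : ℝ → ℝ) (ξ : ℝ) : 0 ≤ Real.exp (-ξ ^ 2 / 4) * (k ξ) ^ 2 := by positivity
  have henorm (k : ℝ → ℝ) (ξ : ℝ) : ENNReal.ofReal (Real.exp (-ξ ^ 2 / 4) * (k ξ) ^ 2)
      = ENNReal.ofReal (Real.exp (-ξ ^ 2 / 4)) * ‖k ξ‖ₑ ^ 2 := by
    rw [ENNReal.ofReal_mul (Real.exp_pos _).le, ← sq_abs (k ξ), ENNReal.ofReal_pow (abs_nonneg _),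
      Real.enorm_eq_ofReal_abs]
  have hle : ∫⁻ ξ, ENNReal.ofReal (Real.exp (-ξ ^ 2 / 4) * (g ξ) ^ 2)
      ≤ ENNReal.ofReal (2 * ∫ ξ : ℝ, Real.exp (-ξ ^ 2 / 4) * (f ξ) ^ 2) := by
    rw [ENNReal.ofReal_mul zero_le_two, ENNReal.ofReal_ofNat,
      ofReal_integral_eq_lintegral_ofReal hfin (Eventually.of_forall (hnonneg f))]
    simp only [henorm]
    simp only [hg]
    exact lintegral_exp_mul_primitive_sq_le hloc.aestronglyMeasurable.aemeasurable
  refine ⟨⟨hmeas, ?_⟩, ?_⟩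
  · rw [hasFiniteIntegral_iff_ofReal (Eventually.of_forall (hnonneg g))]
    exact hle.trans_lt ENNReal.ofReal_lt_top
  · rw [integral_eq_lintegral_of_nonneg_ae (Eventually.of_forall (hnonneg g)) hmeas]
    exact ENNReal.toReal_le_of_le_ofReal
      (mul_nonneg zero_le_two (integral_nonneg (hnonneg f))) hle
end

section
/- There exists a numerical constant C (independent of L₁, L₂, L₃, and f) with the following property: for all real numbers 4 ≤ L₁ < L₂ < L₃ and every continuously differentiable function f : ℝ → ℝ, L₂²·∫_{L₂ ≤ ξ ≤ L₃} e^{-ξ²/4}·f(ξ)² dξ ≤ C·∫_{L₁ ≤ ξ ≤ L₃} e^{-ξ²/4}·f'(ξ)² dξ + C·(L₂ − L₁)^{-2}·∫_{L₁ ≤ ξ ≤ L₂} e^{-ξ²/4}·f(ξ)² dξ. -/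
open Filter Set intervalIntegral

/-- Integrating `(e^{-ξ²/4} ξ g²)'` over `[a, b]` and absorbing the cross term bounds the weighted
`L²` norm of `g` by that of its derivative, up to boundary terms. -/
lemma gaussian_boundary_le {a b : ℝ} (ha : 4 ≤ a) (hab : a ≤ b) {g g' : ℝ → ℝ}
    (hg : ∀ x, HasDerivAt g (g' x) x) (hg' : Continuous g') :
    Real.exp (-b ^ 2 / 4) * b * (g b) ^ 2 - Real.exp (-a ^ 2 / 4) * a * (g a) ^ 2
      ≤ 4 * (∫ ξ in a..b, Real.exp (-ξ ^ 2 / 4) * (g' ξ) ^ 2)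
        - 3 / 16 * a ^ 2 * ∫ ξ in a..b, Real.exp (-ξ ^ 2 / 4) * (g ξ) ^ 2 := by
  have hgc : Continuous g := continuous_iff_continuousAt.2 fun x => (hg x).continuousAt
  have hderiv : ∀ x ∈ uIcc a b, HasDerivAt (fun ξ => Real.exp (-ξ ^ 2 / 4) * ξ * (g ξ) ^ 2)
      (Real.exp (-x ^ 2 / 4) * ((g x) ^ 2 - x ^ 2 / 2 * (g x) ^ 2 + 2 * x * g x * g' x)) x := by
    intro x _
    have hw : HasDerivAt (fun ξ : ℝ => Real.exp (-ξ ^ 2 / 4))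
        (Real.exp (-x ^ 2 / 4) * (-(2 * x) / 4)) x := by
      simpa using (((hasDerivAt_id x).pow 2).neg.div_const 4).exp
    refine ((hw.mul (hasDerivAt_id x)).mul ((hg x).pow 2)).congr_deriv ?_
    simp
    ring
  rw [← integral_eq_sub_of_hasDerivAt hderiv (Continuous.intervalIntegrable (by fun_prop) _ _),
    ← integral_const_mul, ← integral_const_mul,
    ← integral_sub (Continuous.intervalIntegrable (by fun_prop) _ _)
      (Continuous.intervalIntegrable (by fun_prop) _ _)]
  refine integral_mono_on hab (Continuous.intervalIntegrable (by fun_prop) _ _)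
    (Continuous.intervalIntegrable (by fun_prop) _ _) fun x hx => ?_
  have hax : a ^ 2 ≤ x ^ 2 := by nlinarith [hx.1]
  have hx4 : 16 ≤ x ^ 2 := by nlinarith
  have hpt : (g x) ^ 2 - x ^ 2 / 2 * (g x) ^ 2 + 2 * x * g x * g' x
      ≤ 4 * (g' x) ^ 2 - 3 / 16 * a ^ 2 * (g x) ^ 2 := by
    nlinarith [sq_nonneg (x * g x / 2 - 2 * g' x),
      mul_le_mul_of_nonneg_right hax (sq_nonneg (g x)),
      mul_le_mul_of_nonneg_right hx4 (sq_nonneg (g x))]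
  calc _ ≤ Real.exp (-x ^ 2 / 4) * (4 * (g' x) ^ 2 - 3 / 16 * a ^ 2 * (g x) ^ 2) :=
        mul_le_mul_of_nonneg_left hpt (Real.exp_pos _).le
    _ = _ := by ring

/-- A weighted trace inequality, obtained by multiplying `f` with the affine cutoff on `[a, b]`. -/
lemma gaussian_trace_le {a b : ℝ} (ha : 4 ≤ a) (hab : a < b) {f f' : ℝ → ℝ}
    (hf : ∀ x, HasDerivAt f (f' x) x) (hf' : Continuous f') :
    Real.exp (-b ^ 2 / 4) * b * (f b) ^ 2
      ≤ 8 * (∫ ξ in a..b, Real.exp (-ξ ^ 2 / 4) * (f' ξ) ^ 2)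
        + 8 * ((b - a) ^ 2)⁻¹ * ∫ ξ in a..b, Real.exp (-ξ ^ 2 / 4) * (f ξ) ^ 2 := by
  have hfc : Continuous f := continuous_iff_continuousAt.2 fun x => (hf x).continuousAt
  have hba : 0 < b - a := sub_pos.2 hab
  have hg : ∀ x, HasDerivAt (fun ξ => (ξ - a) / (b - a) * f ξ)
      (1 / (b - a) * f x + (x - a) / (b - a) * f' x) x := fun x =>
    (((hasDerivAt_id x).sub_const a).div_const (b - a)).mul (hf x)
  have h := gaussian_boundary_le ha hab.le hg (by fun_prop)
  have hnonneg : 0 ≤ ∫ ξ in a..b, Real.exp (-ξ ^ 2 / 4) * ((ξ - a) / (b - a) * f ξ) ^ 2 :=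
    integral_nonneg hab.le fun x _ => by positivity
  have hmono : 4 * (∫ ξ in a..b, Real.exp (-ξ ^ 2 / 4) *
        (1 / (b - a) * f ξ + (ξ - a) / (b - a) * f' ξ) ^ 2)
      ≤ 8 * (∫ ξ in a..b, Real.exp (-ξ ^ 2 / 4) * (f' ξ) ^ 2)
        + 8 * ((b - a) ^ 2)⁻¹ * ∫ ξ in a..b, Real.exp (-ξ ^ 2 / 4) * (f ξ) ^ 2 := by
    rw [← integral_const_mul, ← integral_const_mul, ← integral_const_mul,
      ← integral_add (Continuous.intervalIntegrable (by fun_prop) _ _)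
        (Continuous.intervalIntegrable (by fun_prop) _ _)]
    refine integral_mono_on hab.le (Continuous.intervalIntegrable (by fun_prop) _ _)
      (Continuous.intervalIntegrable (by fun_prop) _ _) fun x hx => ?_
    have h0 : 0 ≤ (x - a) / (b - a) := div_nonneg (sub_nonneg.2 hx.1) hba.le
    have h1 : (x - a) / (b - a) ≤ 1 := (div_le_one hba).2 (by linarith [hx.2])
    have hsq : ((x - a) / (b - a)) ^ 2 ≤ 1 := pow_le_one₀ h0 h1
    have hpt : 4 * (1 / (b - a) * f x + (x - a) / (b - a) * f' x) ^ 2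
        ≤ 8 * (f' x) ^ 2 + 8 * (1 / (b - a)) ^ 2 * (f x) ^ 2 := by
      nlinarith [sq_nonneg (1 / (b - a) * f x - (x - a) / (b - a) * f' x),
        mul_le_mul_of_nonneg_right hsq (sq_nonneg (f' x))]
    calc _ = Real.exp (-x ^ 2 / 4) *
          (4 * (1 / (b - a) * f x + (x - a) / (b - a) * f' x) ^ 2) := by ring
      _ ≤ Real.exp (-x ^ 2 / 4) * (8 * (f' x) ^ 2 + 8 * (1 / (b - a)) ^ 2 * (f x) ^ 2) :=
        mul_le_mul_of_nonneg_left hpt (Real.exp_pos _).le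
      _ = _ := by rw [one_div, inv_pow]; ring
  simp only [div_self hba.ne', sub_self, zero_div, one_mul, zero_mul] at h
  nlinarith [mul_nonneg (sq_nonneg a) hnonneg]

/-- weighted Poincaré inequality in the cylindrical region,
Lemma 9.1 of the paper. -/
theorem stmt_13 :
    ∃ C > (0:ℝ), ∀ L₁ L₂ L₃ : ℝ, 4 ≤ L₁ → L₁ < L₂ → L₂ < L₃ →
      ∀ f : ℝ → ℝ, ContDiff ℝ 1 f →
        L₂ ^ 2 * (∫ ξ in L₂..L₃, Real.exp (-ξ ^ 2 / 4) * (f ξ) ^ 2)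
          ≤ C * (∫ ξ in L₁..L₃, Real.exp (-ξ ^ 2 / 4) * (deriv f ξ) ^ 2)
            + C * ((L₂ - L₁) ^ 2)⁻¹ * ∫ ξ in L₁..L₂, Real.exp (-ξ ^ 2 / 4) * (f ξ) ^ 2 := by
  refine ⟨128 / 3, by norm_num, fun L₁ L₂ L₃ h₁ h₁₂ h₂₃ f hf => ?_⟩
  have hd : ∀ x, HasDerivAt f (deriv f x) x := fun x =>
    (hf.differentiable one_ne_zero x).hasDerivAt
  have hc : Continuous (deriv f) := hf.continuous_deriv_one
  have htrace := gaussian_trace_le h₁ h₁₂ hd hc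
  have hbdry := gaussian_boundary_le (h₁.trans h₁₂.le) h₂₃.le hd hc
  have hend : 0 ≤ Real.exp (-L₃ ^ 2 / 4) * L₃ * (f L₃) ^ 2 := by
    have : 0 ≤ L₃ := by linarith
    positivity
  have hnonneg : 0 ≤ ∫ ξ in L₂..L₃, Real.exp (-ξ ^ 2 / 4) * (deriv f ξ) ^ 2 :=
    integral_nonneg h₂₃.le fun x _ => by positivity
  rw [← integral_add_adjacent_intervals (a := L₁) (b := L₂) (c := L₃)
    (Continuous.intervalIntegrable (by fun_prop) _ _)
    (Continuous.intervalIntegrable (by fun_prop) _ _)]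
  linarith
end

section
/- Let λ > 0, c > 0, and τ* < 0. Let I : (−∞,τ*] → [0,∞) be continuously differentiable and J : (−∞,τ*] → [0,∞) be continuous with M := sup_{τ ≤ τ*} (−τ)^{-1}·J(τ) < ∞. Suppose (1/2)·I'(τ) + λ·(−τ)·I(τ) ≤ c·J(τ) for all τ ≤ τ*, and e^{-λτ²}·I(τ) → 0 as τ → −∞. Then for every τ ≤ τ*, (−τ)^{-1/2}·I(τ) ≤ c·λ^{-1}·(−τ)^{-1}·sup_{τ' ≤ τ} (−τ')^{-1/2}·J(τ'); in particular, sup_{τ ≤ τ*} (−τ)^{-1/2}·I(τ) ≤ c·λ^{-1}·(−τ*)^{-1}·sup_{τ ≤ τ*} (−τ)^{-1/2}·J(τ). -/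
open Filter Set

/-- The Gaussian weight `exp (-lam * τ ^ 2)` vanishes as `τ → -∞`. -/
theorem tendsto_exp_neg_mul_sq_atBot {lam : ℝ} (hlam : 0 < lam) :
    Tendsto (fun τ : ℝ => Real.exp (-lam * τ ^ 2)) atBot (nhds 0) := by
  have hsq : Tendsto (fun τ : ℝ => τ ^ 2) atBot atTop := by
    simpa [Function.comp_def] using
      (tendsto_pow_atTop (α := ℝ) two_ne_zero).comp tendsto_neg_atBot_atTop
  exact Real.tendsto_exp_atBot.comp (hsq.const_mul_atTop_of_neg (neg_neg_of_pos hlam))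

/-- A supersolution comparison: if `I' - 2 lam s I ≤ -2 lam s K` on `(-∞, τ]` and
`exp (-lam * s ^ 2) * I s` vanishes at `-∞`, then `I τ ≤ K`. -/
theorem le_of_deriv_le_of_tendsto_weighted {lam τ K : ℝ} {I : ℝ → ℝ} (hlam : 0 < lam)
    (hI : ∀ s ≤ τ, DifferentiableAt ℝ I s)
    (hle : ∀ s ≤ τ, deriv I s + 2 * lam * (-s) * I s ≤ 2 * lam * (-s) * K)
    (hlim : Tendsto (fun s => Real.exp (-lam * s ^ 2) * I s) atBot (nhds 0)) :
    I τ ≤ K := by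
  set g : ℝ → ℝ := fun s => Real.exp (-lam * s ^ 2) * (I s - K) with hg
  have hderiv : ∀ s ≤ τ, HasDerivAt g (Real.exp (-lam * s ^ 2) *
      (deriv I s + 2 * lam * (-s) * I s - 2 * lam * (-s) * K)) s := by
    intro s hs
    have hexp : HasDerivAt (fun s : ℝ => Real.exp (-lam * s ^ 2))
        (Real.exp (-lam * s ^ 2) * (-lam * (2 * s))) s := by
      simpa using ((hasDerivAt_pow 2 s).const_mul (-lam)).exp
    exact (hexp.mul ((hI s hs).hasDerivAt.sub_const K)).congr_deriv (by ring)
  have hanti : AntitoneOn g (Iic τ) := by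
    refine antitoneOn_of_deriv_nonpos (convex_Iic τ)
      (fun s hs => (hderiv s hs).continuousAt.continuousWithinAt)
      (fun s hs => (hderiv s (mem_Iic.1 (interior_subset hs))).differentiableAt.differentiableWithinAt)
      fun s hs => ?_
    have hs' : s ≤ τ := mem_Iic.1 (interior_subset hs)
    rw [(hderiv s hs').deriv]
    exact mul_nonpos_of_nonneg_of_nonpos (Real.exp_pos _).le (by linarith [hle s hs'])
  have hg0 : Tendsto g atBot (nhds 0) := by
    have h := hlim.sub ((tendsto_exp_neg_mul_sq_atBot hlam).mul_const K)
    simpa [hg, mul_sub] using h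
  have hgτ : g τ ≤ 0 := ge_of_tendsto hg0 <| by
    filter_upwards [eventually_le_atBot τ] with s hs
    exact hanti hs self_mem_Iic hs
  linarith [nonpos_of_mul_nonpos_right hgτ (Real.exp_pos _)]

/-- Gronwall-type argument concluding Section 7 of the paper.
The suprema `sup_{τ' ≤ τ} (−τ')^{-1/2} J(τ')` are encoded by quantifying over
arbitrary upper bounds `S`. -/
theorem stmt_14 (lam c τstar : ℝ) (hlam : 0 < lam) (hc : 0 < c) (hτ : τstar < 0)
    (I J : ℝ → ℝ)
    (hI0 : ∀ τ ≤ τstar, 0 ≤ I τ) (hJ0 : ∀ τ ≤ τstar, 0 ≤ J τ)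
    (hIdiff : ∀ τ ≤ τstar, DifferentiableAt ℝ I τ)
    (hIcont : ContinuousOn (deriv I) (Set.Iic τstar))
    (hJcont : ContinuousOn J (Set.Iic τstar))
    (M : ℝ) (hM : ∀ τ ≤ τstar, (-τ)⁻¹ * J τ ≤ M)
    (hineq : ∀ τ ≤ τstar, (1/2) * deriv I τ + lam * (-τ) * I τ ≤ c * J τ)
    (hlim : Tendsto (fun τ => Real.exp (-lam * τ ^ 2) * I τ) atBot (nhds 0)) :
    (∀ τ ≤ τstar, ∀ S : ℝ, (∀ τ' ≤ τ, (Real.sqrt (-τ'))⁻¹ * J τ' ≤ S) →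
      (Real.sqrt (-τ))⁻¹ * I τ ≤ c * lam⁻¹ * (-τ)⁻¹ * S) ∧
    (∀ S : ℝ, (∀ τ ≤ τstar, (Real.sqrt (-τ))⁻¹ * J τ ≤ S) →
      ∀ τ ≤ τstar, (Real.sqrt (-τ))⁻¹ * I τ ≤ c * lam⁻¹ * (-τstar)⁻¹ * S) := by
  have main : ∀ τ ≤ τstar, ∀ S : ℝ, (∀ τ' ≤ τ, (Real.sqrt (-τ'))⁻¹ * J τ' ≤ S) →
      (Real.sqrt (-τ))⁻¹ * I τ ≤ c * lam⁻¹ * (-τ)⁻¹ * S := by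
    intro τ hττ S hS
    have hpos : 0 < Real.sqrt (-τ) := Real.sqrt_pos.2 (by linarith)
    have hS0 : 0 ≤ S :=
      (mul_nonneg (inv_nonneg.2 hpos.le) (hJ0 τ hττ)).trans (hS τ le_rfl)
    have hIτ : I τ ≤ c * lam⁻¹ * (Real.sqrt (-τ))⁻¹ * S := by
      refine le_of_deriv_le_of_tendsto_weighted hlam (fun s hs => hIdiff s (hs.trans hττ))
        (fun s hs => ?_) hlim
      have hspos : 0 < Real.sqrt (-s) := Real.sqrt_pos.2 (by linarith)
      have hJ : J s ≤ Real.sqrt (-s) * S := (inv_mul_le_iff₀ hspos).1 (hS s hs)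
      have hsqrt : Real.sqrt (-s) ≤ -s * (Real.sqrt (-τ))⁻¹ := by
        rw [← div_eq_mul_inv, le_div_iff₀ hpos]
        calc Real.sqrt (-s) * Real.sqrt (-τ) ≤ Real.sqrt (-s) * Real.sqrt (-s) := by gcongr
          _ = -s := Real.mul_self_sqrt (by linarith)
      have hcJ : c * J s ≤ c * (-s * (Real.sqrt (-τ))⁻¹ * S) := by
        gcongr
        exact hJ.trans (by gcongr)
      have hcancel : 2 * lam * (-s) * (c * lam⁻¹ * (Real.sqrt (-τ))⁻¹ * S) =
          2 * (c * (-s * (Real.sqrt (-τ))⁻¹ * S)) := by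
        field_simp
      rw [hcancel]
      linarith [hineq s (hs.trans hττ)]
    calc (Real.sqrt (-τ))⁻¹ * I τ
        ≤ (Real.sqrt (-τ))⁻¹ * (c * lam⁻¹ * (Real.sqrt (-τ))⁻¹ * S) := by gcongr
      _ = c * lam⁻¹ * (Real.sqrt (-τ) * Real.sqrt (-τ))⁻¹ * S := by rw [mul_inv]; ring
      _ = c * lam⁻¹ * (-τ)⁻¹ * S := by rw [Real.mul_self_sqrt (by linarith)]
  refine ⟨main, fun S hS τ hττ => ?_⟩
  have hS0 : 0 ≤ S :=
    (mul_nonneg (inv_nonneg.2 (Real.sqrt_nonneg _)) (hJ0 τ hττ)).trans (hS τ hττ)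
  refine (main τ hττ S fun s hs => hS s (hs.trans hττ)).trans ?_
  have hpos : 0 < -τstar := neg_pos.2 hτ
  gcongr
end

section
/- Let τ* ≤ −1 and δ ∈ (0,1). Let a : (−∞,τ*] → ℝ be continuously differentiable and bounded, with a(τ*) = 0. Define Q(τ) := a'(τ) − 2·(−τ)^{-1}·a(τ), and assume Q is continuous. Suppose that ∫_{τ−1}^{τ} (−τ')·|Q(τ')| dτ' ≤ δ·sup_{τ' ≤ τ*} |a(τ')| for all τ ≤ τ*. Then a(τ) = 0 for all τ ≤ τ*. -/
open Filter Set intervalIntegral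

/-- If every integral of `g` over a unit interval ending at or before `b` is at most `M`, then the
integral over the interval of length `n` ending at `b` is at most `n * M`. -/
theorem integral_le_nat_mul_of_unit_integral_le {g : ℝ → ℝ} {b M : ℝ}
    (hg : ContinuousOn g (Iic b)) (h : ∀ t ≤ b, ∫ x in (t - 1)..t, g x ≤ M) (n : ℕ) :
    ∫ x in (b - n)..b, g x ≤ n * M := by
  have hint : ∀ s t, s ≤ b → t ≤ b → IntervalIntegrable g MeasureTheory.volume s t :=
    fun s t hs ht => (hg.mono fun x hx => hx.2.trans (max_le hs ht)).intervalIntegrable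
  induction n with
  | zero => simp
  | succ n ih =>
    have hn : (0 : ℝ) ≤ n := n.cast_nonneg
    have hunit := h (b - n) (by linarith)
    rw [show b - ((n + 1 : ℕ) : ℝ) = b - n - 1 by push_cast; ring,
      ← integral_add_adjacent_intervals (hint (b - n - 1) (b - n) (by linarith) (by linarith))
        (hint (b - n) b (by linarith) le_rfl)]
    push_cast
    linarith

/-- If `g ≥ 0` on `(-∞, b]` with `b ≤ -1`, and every integral of `g` over a unit interval is at
most `M`, then the integral of `g` over `[t, b]` is at most `(-t) * M`. -/
theorem integral_le_neg_mul_of_unit_integral_le {g : ℝ → ℝ} {b M t : ℝ} (hb : b ≤ -1)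
    (hg : ContinuousOn g (Iic b)) (hpos : ∀ x ≤ b, 0 ≤ g x) (hM : 0 ≤ M)
    (h : ∀ t ≤ b, ∫ x in (t - 1)..t, g x ≤ M) (ht : t ≤ b) :
    ∫ x in t..b, g x ≤ -t * M := by
  have hint : ∀ s t, s ≤ b → t ≤ b → IntervalIntegrable g MeasureTheory.volume s t :=
    fun s t hs ht => (hg.mono fun x hx => hx.2.trans (max_le hs ht)).intervalIntegrable
  set n := ⌈b - t⌉₊
  have hn : b - t ≤ n := Nat.le_ceil _
  have hn' : (n : ℝ) < b - t + 1 := Nat.ceil_lt_add_one (by linarith)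
  have hsplit := integral_add_adjacent_intervals
    (hint (b - n) t (by linarith) ht) (hint t b ht le_rfl)
  have hleft : 0 ≤ ∫ x in (b - n)..t, g x :=
    integral_nonneg (by linarith) fun x hx => hpos x (hx.2.trans ht)
  have hsum := integral_le_nat_mul_of_unit_integral_le hg h n
  have hmul : (n : ℝ) * M ≤ -t * M := mul_le_mul_of_nonneg_right (by linarith) hM
  linarith

/-- A solution of `a' = 2 (-t)⁻¹ a + Q` that vanishes at `b < 0` is controlled by the weighted
integral of `|Q|`. -/
theorem neg_mul_abs_le_integral_of_ode {a Q : ℝ → ℝ} {b t : ℝ} (hb : b < 0)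
    (hdiff : ∀ x ≤ b, DifferentiableAt ℝ a x) (hend : a b = 0)
    (hQ : ∀ x ≤ b, Q x = deriv a x - 2 * (-x)⁻¹ * a x) (hQcont : ContinuousOn Q (Iic b))
    (ht : t ≤ b) : -t * |a t| ≤ ∫ x in t..b, -x * |Q x| := by
  have hsub : uIcc t b ⊆ Iic b := fun x hx => hx.2.trans (max_le ht le_rfl)
  have hderiv : ∀ x ∈ uIcc t b, HasDerivAt (fun x => x ^ 2 * a x) (x ^ 2 * Q x) x := by
    intro x hx
    have hxb : x ≤ b := hsub hx
    have hx0 : x ≠ 0 := (hxb.trans_lt hb).ne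
    refine ((hasDerivAt_pow 2 x).mul (hdiff x hxb).hasDerivAt).congr_deriv ?_
    rw [hQ x hxb]
    field_simp
    ring
  have hQ' : ContinuousOn Q (uIcc t b) := hQcont.mono hsub
  have hint : IntervalIntegrable (fun x => x ^ 2 * Q x) MeasureTheory.volume t b :=
    (ContinuousOn.mul (by fun_prop) hQ').intervalIntegrable
  have hftc := integral_eq_sub_of_hasDerivAt hderiv hint
  have hle : |∫ x in t..b, x ^ 2 * Q x| ≤ ∫ x in t..b, -t * (-x * |Q x|) := by
    refine (abs_integral_le_integral_abs ht).trans (integral_mono_on ht hint.abs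
      (ContinuousOn.intervalIntegrable (by fun_prop)) fun x hx => ?_)
    rw [abs_mul, abs_of_nonneg (sq_nonneg x), ← mul_assoc]
    exact mul_le_mul_of_nonneg_right (by nlinarith [hx.1, hx.2]) (abs_nonneg _)
  rw [hftc, hend, mul_zero, zero_sub, abs_neg, abs_mul, abs_of_nonneg (sq_nonneg t),
    integral_const_mul] at hle
  refine le_of_mul_le_mul_left ?_ (show 0 < -t by linarith)
  linarith

/-- the final ODE rigidity argument in the proof of Theorem 1.3. -/
theorem stmt_15 (τstar δ : ℝ) (hτ : τstar ≤ -1) (hδ : δ ∈ Set.Ioo (0:ℝ) 1)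
    (a : ℝ → ℝ)
    (hdiff : ∀ τ ≤ τstar, DifferentiableAt ℝ a τ)
    (hderiv_cont : ContinuousOn (deriv a) (Set.Iic τstar))
    (hbdd : ∃ Cb : ℝ, ∀ τ ≤ τstar, |a τ| ≤ Cb)
    (hend : a τstar = 0)
    (Q : ℝ → ℝ)
    (hQ : ∀ τ ≤ τstar, Q τ = deriv a τ - 2 * (-τ)⁻¹ * a τ)
    (hQcont : ContinuousOn Q (Set.Iic τstar))
    (hQbound : ∀ τ ≤ τstar,
      (∫ τ' in (τ - 1)..τ, (-τ') * |Q τ'|)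
        ≤ δ * sSup ((fun τ' => |a τ'|) '' Set.Iic τstar)) :
    ∀ τ ≤ τstar, a τ = 0 := by
  intro t ht
  set S := sSup ((fun τ' => |a τ'|) '' Iic τstar)
  have hbddAbove : BddAbove ((fun τ' => |a τ'|) '' Iic τstar) := by
    obtain ⟨C, hC⟩ := hbdd
    exact ⟨C, forall_mem_image.2 hC⟩
  have hle : ∀ x ≤ τstar, |a x| ≤ S := fun x hx => le_csSup hbddAbove ⟨x, hx, rfl⟩
  have hS : 0 ≤ S := (abs_nonneg _).trans (hle t ht)
  have hcontr : ∀ x ≤ τstar, |a x| ≤ δ * S := by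
    intro x hx
    refine le_of_mul_le_mul_left ?_ (show 0 < -x by linarith)
    exact (neg_mul_abs_le_integral_of_ode (by linarith) hdiff hend hQ hQcont hx).trans
      (integral_le_neg_mul_of_unit_integral_le hτ (by fun_prop)
        (fun y hy => mul_nonneg (by linarith) (abs_nonneg _)) (mul_nonneg hδ.1.le hS) hQbound hx)
  have hSle : S ≤ δ * S := csSup_le (nonempty_Iic.image _) (forall_mem_image.2 hcontr)
  have hS0 : S ≤ 0 := by nlinarith [hδ.2]
  exact abs_nonpos_iff.1 ((hle t ht).trans hS0)
end

section
/- Let n ≥ 4 be an integer and let Ω ⊆ (0,∞) × ℝ be open. Suppose V₁, V₂ : Ω → (0,∞) are smooth and each V ∈ {V₁, V₂} satisfies V^{-2}·(V_τ + (ρ/2)·V_ρ) = V_ρρ + (n−2)·ρ^{-2}·(V^{-2} − 1)·(ρ·V_ρ + V) + (n−3)·ρ^{-1}·V_ρ on Ω. Then W := V₁ − V₂ satisfies, on Ω, V₁^{-2}·(W_τ + (ρ/2)·W_ρ) = W_ρρ + ∂_ρ(ρ^{-1}·(n−2)·(V₁^{-2} − 1)·W) + (n−3)·ρ^{-1}·W_ρ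 − 2(n−2)·ρ^{-2}·W + V₁^{-2}·𝓑·W, where 𝓑 := (n−2)·ρ^{-2}·(1 − V₁·V₂^{-1}) + (n−2)·ρ^{-1}·(2·V₁^{-1}·∂_ρV₁ − V₂^{-2}·(V₁ + V₂)·∂_ρV₂) + V₂^{-2}·(V₁ + V₂)·(∂_τV₂ + (ρ/2)·∂_ρV₂). -/
open Filter Set
open scoped ContDiff

/-- A horizontal slice of a smooth function on an open set is smooth on the slice of that set. -/
lemma contDiffOn_slice_fst {Ω : Set (ℝ × ℝ)} {V : ℝ → ℝ → ℝ}
    (hV : ContDiffOn ℝ ∞ (fun p : ℝ × ℝ => V p.1 p.2) Ω) (τ : ℝ) :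
    ContDiffOn ℝ ∞ (fun x => V x τ) {x | (x, τ) ∈ Ω} :=
  hV.comp (f := fun x : ℝ => (x, τ)) (by fun_prop) fun _ hx => hx

lemma contDiffOn_slice_snd {Ω : Set (ℝ × ℝ)} {V : ℝ → ℝ → ℝ}
    (hV : ContDiffOn ℝ ∞ (fun p : ℝ × ℝ => V p.1 p.2) Ω) (ρ : ℝ) :
    ContDiffOn ℝ ∞ (fun y => V ρ y) {y | (ρ, y) ∈ Ω} :=
  hV.comp (f := fun y : ℝ => (ρ, y)) (by fun_prop) fun _ hy => hy

lemma isOpen_slice_fst {Ω : Set (ℝ × ℝ)} (hΩ : IsOpen Ω) (τ : ℝ) : IsOpen {x | (x, τ) ∈ Ω} :=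
  hΩ.preimage (by fun_prop : Continuous fun x : ℝ => (x, τ))

lemma isOpen_slice_snd {Ω : Set (ℝ × ℝ)} (hΩ : IsOpen Ω) (ρ : ℝ) : IsOpen {y | (ρ, y) ∈ Ω} :=
  hΩ.preimage (by fun_prop : Continuous fun y : ℝ => (ρ, y))

lemma differentiableAt_slice_fst {Ω : Set (ℝ × ℝ)} (hΩ : IsOpen Ω) {V : ℝ → ℝ → ℝ}
    (hV : ContDiffOn ℝ ∞ (fun p : ℝ × ℝ => V p.1 p.2) Ω) {ρ τ : ℝ} (h : (ρ, τ) ∈ Ω) :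
    DifferentiableAt ℝ (fun x => V x τ) ρ :=
  ((contDiffOn_slice_fst hV τ).differentiableOn (by simp)).differentiableAt
    ((isOpen_slice_fst hΩ τ).mem_nhds h)

lemma differentiableAt_slice_snd {Ω : Set (ℝ × ℝ)} (hΩ : IsOpen Ω) {V : ℝ → ℝ → ℝ}
    (hV : ContDiffOn ℝ ∞ (fun p : ℝ × ℝ => V p.1 p.2) Ω) {ρ τ : ℝ} (h : (ρ, τ) ∈ Ω) :
    DifferentiableAt ℝ (fun y => V ρ y) τ :=
  ((contDiffOn_slice_snd hV ρ).differentiableOn (by simp)).differentiableAt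
    ((isOpen_slice_snd hΩ ρ).mem_nhds h)

lemma differentiableAt_d1_slice_fst {Ω : Set (ℝ × ℝ)} (hΩ : IsOpen Ω) {V : ℝ → ℝ → ℝ}
    (hV : ContDiffOn ℝ ∞ (fun p : ℝ × ℝ => V p.1 p.2) Ω) {ρ τ : ℝ} (h : (ρ, τ) ∈ Ω) :
    DifferentiableAt ℝ (fun x => d1 V x τ) ρ :=
  (((contDiffOn_infty_iff_deriv_of_isOpen (isOpen_slice_fst hΩ τ)).1
    (contDiffOn_slice_fst hV τ)).2.differentiableOn (by simp)).differentiableAt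
    ((isOpen_slice_fst hΩ τ).mem_nhds h)

/-- Proposition 7.1 of the paper: the equation satisfied by the
difference `W = V₁ − V₂` of two solutions of the rescaled tip region equation. -/
theorem stmt_16 (n : ℕ) (hn : 4 ≤ n) (Ω : Set (ℝ × ℝ)) (hΩopen : IsOpen Ω)
    (hΩsub : Ω ⊆ Set.Ioi (0:ℝ) ×ˢ (Set.univ : Set ℝ))
    (V₁ V₂ : ℝ → ℝ → ℝ)
    (hV₁smooth : ContDiffOn ℝ ∞ (fun p : ℝ × ℝ => V₁ p.1 p.2) Ω)
    (hV₂smooth : ContDiffOn ℝ ∞ (fun p : ℝ × ℝ => V₂ p.1 p.2) Ω)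
    (hV₁pos : ∀ ρ τ : ℝ, (ρ, τ) ∈ Ω → 0 < V₁ ρ τ)
    (hV₂pos : ∀ ρ τ : ℝ, (ρ, τ) ∈ Ω → 0 < V₂ ρ τ)
    (hV₁eq : ∀ ρ τ : ℝ, (ρ, τ) ∈ Ω →
      (V₁ ρ τ) ^ (-2:ℤ) * (d2 V₁ ρ τ + ρ / 2 * d1 V₁ ρ τ)
        = d1 (d1 V₁) ρ τ
          + ((n:ℝ) - 2) * ρ ^ (-2:ℤ) * ((V₁ ρ τ) ^ (-2:ℤ) - 1) * (ρ * d1 V₁ ρ τ + V₁ ρ τ)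
          + ((n:ℝ) - 3) * ρ⁻¹ * d1 V₁ ρ τ)
    (hV₂eq : ∀ ρ τ : ℝ, (ρ, τ) ∈ Ω →
      (V₂ ρ τ) ^ (-2:ℤ) * (d2 V₂ ρ τ + ρ / 2 * d1 V₂ ρ τ)
        = d1 (d1 V₂) ρ τ
          + ((n:ℝ) - 2) * ρ ^ (-2:ℤ) * ((V₂ ρ τ) ^ (-2:ℤ) - 1) * (ρ * d1 V₂ ρ τ + V₂ ρ τ)
          + ((n:ℝ) - 3) * ρ⁻¹ * d1 V₂ ρ τ)
    (W : ℝ → ℝ → ℝ) (hW : ∀ ρ τ : ℝ, W ρ τ = V₁ ρ τ - V₂ ρ τ)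
    (B : ℝ → ℝ → ℝ)
    (hB : ∀ ρ τ : ℝ, B ρ τ
      = ((n:ℝ) - 2) * ρ ^ (-2:ℤ) * (1 - V₁ ρ τ * (V₂ ρ τ)⁻¹)
        + ((n:ℝ) - 2) * ρ⁻¹ * (2 * (V₁ ρ τ)⁻¹ * d1 V₁ ρ τ
            - (V₂ ρ τ) ^ (-2:ℤ) * (V₁ ρ τ + V₂ ρ τ) * d1 V₂ ρ τ)
        + (V₂ ρ τ) ^ (-2:ℤ) * (V₁ ρ τ + V₂ ρ τ) * (d2 V₂ ρ τ + ρ / 2 * d1 V₂ ρ τ)) :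
    ∀ ρ τ : ℝ, (ρ, τ) ∈ Ω →
      (V₁ ρ τ) ^ (-2:ℤ) * (d2 W ρ τ + ρ / 2 * d1 W ρ τ)
        = d1 (d1 W) ρ τ
          + d1 (fun r t => r⁻¹ * ((n:ℝ) - 2) * ((V₁ r t) ^ (-2:ℤ) - 1) * W r t) ρ τ
          + ((n:ℝ) - 3) * ρ⁻¹ * d1 W ρ τ
          - 2 * ((n:ℝ) - 2) * ρ ^ (-2:ℤ) * W ρ τ
          + (V₁ ρ τ) ^ (-2:ℤ) * B ρ τ * W ρ τ := by
  intro ρ τ h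
  obtain rfl : W = fun ρ τ => V₁ ρ τ - V₂ ρ τ := by
    funext ρ τ
    exact hW ρ τ
  have hρ : ρ ≠ 0 := ne_of_gt (hΩsub h).1
  have ha : V₁ ρ τ ≠ 0 := (hV₁pos ρ τ h).ne'
  have hb : V₂ ρ τ ≠ 0 := (hV₂pos ρ τ h).ne'
  have hW1 : ∀ x, (x, τ) ∈ Ω →
      d1 (fun ρ τ => V₁ ρ τ - V₂ ρ τ) x τ = d1 V₁ x τ - d1 V₂ x τ := fun x hx =>
    deriv_fun_sub (differentiableAt_slice_fst hΩopen hV₁smooth hx)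
      (differentiableAt_slice_fst hΩopen hV₂smooth hx)
  have hW2 : d2 (fun ρ τ => V₁ ρ τ - V₂ ρ τ) ρ τ = d2 V₁ ρ τ - d2 V₂ ρ τ :=
    deriv_fun_sub (differentiableAt_slice_snd hΩopen hV₁smooth h)
      (differentiableAt_slice_snd hΩopen hV₂smooth h)
  have hW11 : d1 (d1 fun ρ τ => V₁ ρ τ - V₂ ρ τ) ρ τ = d1 (d1 V₁) ρ τ - d1 (d1 V₂) ρ τ := by
    have heq : (fun x => d1 (fun ρ τ => V₁ ρ τ - V₂ ρ τ) x τ)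
        =ᶠ[nhds ρ] fun x => d1 V₁ x τ - d1 V₂ x τ := by
      filter_upwards [(isOpen_slice_fst hΩopen τ).mem_nhds h] with x hx using hW1 x hx
    exact heq.deriv_eq.trans
      (deriv_fun_sub (differentiableAt_d1_slice_fst hΩopen hV₁smooth h)
        (differentiableAt_d1_slice_fst hΩopen hV₂smooth h))
  have hA : HasDerivAt (fun x => V₁ x τ) (d1 V₁ ρ τ) ρ :=
    (differentiableAt_slice_fst hΩopen hV₁smooth h).hasDerivAt
  have hC : HasDerivAt (fun x => V₂ x τ) (d1 V₂ ρ τ) ρ :=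
    (differentiableAt_slice_fst hΩopen hV₂smooth h).hasDerivAt
  have hpow : HasDerivAt (fun x => V₁ x τ ^ (-2:ℤ))
      (((-2:ℤ) : ℝ) * V₁ ρ τ ^ (-2 - 1:ℤ) * d1 V₁ ρ τ) ρ :=
    HasDerivAt.comp (h₂ := fun x : ℝ => x ^ (-2:ℤ)) ρ
      (hasDerivAt_zpow (-2) (V₁ ρ τ) (Or.inl ha)) hA
  have hflux : d1 (fun r t => r⁻¹ * ((n:ℝ) - 2) * ((V₁ r t) ^ (-2:ℤ) - 1)
      * (V₁ r t - V₂ r t)) ρ τ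
      = (-(ρ ^ 2)⁻¹ * ((n:ℝ) - 2) * (V₁ ρ τ ^ (-2:ℤ) - 1)
          + ρ⁻¹ * ((n:ℝ) - 2) * (((-2:ℤ) : ℝ) * V₁ ρ τ ^ (-2 - 1:ℤ) * d1 V₁ ρ τ))
            * (V₁ ρ τ - V₂ ρ τ)
        + ρ⁻¹ * ((n:ℝ) - 2) * (V₁ ρ τ ^ (-2:ℤ) - 1) * (d1 V₁ ρ τ - d1 V₂ ρ τ) :=
    ((((hasDerivAt_inv hρ).mul_const ((n:ℝ) - 2)).fun_mul (hpow.sub_const 1)).fun_mul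
      (hA.fun_sub hC)).deriv
  have e₁ := hV₁eq ρ τ h
  have e₂ := hV₂eq ρ τ h
  have hz : ∀ x : ℝ, x ^ (-2:ℤ) = (x⁻¹) ^ 2 := fun x => by
    rw [zpow_neg, inv_pow]; rfl
  have hz' : ∀ x : ℝ, x ^ (-2 - 1:ℤ) = (x⁻¹) ^ 3 := fun x => by
    rw [show (-2 - 1:ℤ) = -3 by norm_num, zpow_neg, inv_pow]; rfl
  beta_reduce
  rw [hflux, hW11, hW2, hW1 ρ h, hB]
  simp only [hz, hz'] at e₁ e₂ ⊢
  push_cast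
  linear_combination (norm := skip) e₁ - e₂
  field_simp
  ring
end
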